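/- The monoid G_Hiii⁺ admits neither the left-divisibility theory nor the right-divisibility theory; that is, it is NOT the case that every pair of elements of G_Hiii⁺ has a left least common multiple, and it is NOT the case that every pair of elements of G_Hiii⁺ has a right least common multiple. -/

import Mathlib

/-- The three generators. -/
inductive Gen3 : Type
  | a | b | c

open FreeGroup in
/-- The defining relations of `G_Hiii`. -/
def theRels : Set (FreeGroup Gen3) :=
  { of .a * of .b * of .a * (of .b * of .a * of .b)⁻¹,
    of .b * of .c * of .b * of .a * (of .c * of .b * of .a * of .c)⁻¹,
    of .c * of .b * of .a * (of .a * of .c * of .b)⁻¹ }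

/-- The group `G_Hiii`. -/
abbrev G : Type := PresentedGroup theRels

/-- The monoid `G_Hiii⁺`: the submonoid of `G_Hiii` generated by the images of `a, b, c`. -/
abbrev Gplus : Submonoid G :=
  Submonoid.closure {PresentedGroup.of Gen3.a, PresentedGroup.of Gen3.b, PresentedGroup.of Gen3.c}

open Matrix in
/-- Images of the generators in `SL(2, 𝔽₅)`. -/
def slGen : Gen3 → SpecialLinearGroup (Fin 2) (ZMod 5)
  | .a => ⟨!![1, 1; 0, 1], by decide⟩
  | .b => ⟨!![0, 1; 4, 2], by decide⟩
  | .c => ⟨!![2, 1; 4, 0], by decide⟩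

/-- A representation of `G` in `SL(2, 𝔽₅)`. -/
def toSL : G →* Matrix.SpecialLinearGroup (Fin 2) (ZMod 5) :=
  PresentedGroup.toGroup (f := slGen) (by
    rintro r (rfl | rfl | rfl) <;>
      simp only [map_mul, map_inv, FreeGroup.lift_apply_of] <;> rw [mul_inv_eq_one] <;> decide)

/-- The length homomorphism, sending every generator to `1`. -/
def wordLength : G →* Multiplicative ℤ :=
  PresentedGroup.toGroup (f := fun _ => Multiplicative.ofAdd 1) (by
    rintro r (rfl | rfl | rfl) <;>
      simp only [map_mul, map_inv, FreeGroup.lift_apply_of] <;> rw [mul_inv_eq_one])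

/-- The image of a generator in `G`. -/
abbrev gen (x : Gen3) : G := PresentedGroup.of x

/-- The element of `G` represented by a positive word. -/
def ofWord (l : List Gen3) : G := (l.map gen).prod

@[simp] lemma ofWord_nil : ofWord [] = 1 := rfl

@[simp] lemma ofWord_singleton (x : Gen3) : ofWord [x] = gen x := by simp [ofWord]

@[simp] lemma toSL_gen (x : Gen3) : toSL (gen x) = slGen x := PresentedGroup.toGroup.of _

@[simp] lemma wordLength_gen (x : Gen3) : wordLength (gen x) = Multiplicative.ofAdd 1 :=
  PresentedGroup.toGroup.of _

@[simp] lemma wordLength_ofWord (l : List Gen3) :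
    wordLength (ofWord l) = Multiplicative.ofAdd (l.length : ℤ) := by
  induction l with
  | nil => simp
  | cons x l ih =>
    rw [show ofWord (x :: l) = gen x * ofWord l by simp [ofWord], map_mul, ih, wordLength_gen,
      ← ofAdd_add, List.length_cons, Nat.cast_succ, add_comm]

lemma gen_mem (x : Gen3) : gen x ∈ Gplus :=
  Submonoid.subset_closure (by cases x <;> simp)

lemma exists_ofWord_eq (g : Gplus) : ∃ l, (g : G) = ofWord l := by
  obtain ⟨g, hg⟩ := g
  induction hg using Submonoid.closure_induction with
  | mem x hx =>
    obtain rfl | rfl | rfl := hx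
    exacts [⟨[.a], (ofWord_singleton _).symm⟩, ⟨[.b], (ofWord_singleton _).symm⟩,
      ⟨[.c], (ofWord_singleton _).symm⟩]
  | one => exact ⟨[], rfl⟩
  | mul x y _ _ hx hy =>
    obtain ⟨l, hl⟩ := hx
    obtain ⟨k, hk⟩ := hy
    dsimp only at hl hk ⊢
    exact ⟨l ++ k, by simp [hl, hk, ofWord]⟩

lemma gen_injective : Function.Injective gen := by
  intro x y h
  have := congrArg toSL h
  rw [toSL_gen, toSL_gen] at this
  revert this
  cases x <;> cases y <;> simp only [imp_true_iff, reduceCtorEq, imp_false] <;> decide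

lemma gen_a_mul_ne_gen_c_mul (x y : Gen3) : gen .a * gen x ≠ gen .c * gen y := by
  intro h
  have := congrArg toSL h
  simp only [map_mul, toSL_gen] at this
  revert this
  cases x <;> cases y <;> decide

lemma mul_gen_a_ne_mul_gen_b (x y : Gen3) : gen x * gen .a ≠ gen y * gen .b := by
  intro h
  have := congrArg toSL h
  simp only [map_mul, toSL_gen] at this
  revert this
  cases x <;> cases y <;> decide

lemma aba_eq_bab : gen .a * gen .b * gen .a = gen .b * gen .a * gen .b :=
  mul_inv_eq_one.1 (PresentedGroup.one_of_mem (by simp [theRels]))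

lemma bcba_eq_cbac : gen .b * gen .c * gen .b * gen .a = gen .c * gen .b * gen .a * gen .c :=
  mul_inv_eq_one.1 (PresentedGroup.one_of_mem (by simp [theRels]))

lemma cba_eq_acb : gen .c * gen .b * gen .a = gen .a * gen .c * gen .b :=
  mul_inv_eq_one.1 (PresentedGroup.one_of_mem (by simp [theRels]))

/-- Conjugating the braid relation `aba = bab` by `cba`, which commutes with `a` and
conjugates `b` to `c`. -/
lemma aca_eq_cac : gen .a * gen .c * gen .a = gen .c * gen .a * gen .c := by
  have ha : SemiconjBy (gen .c * gen .b * gen .a) (gen .a) (gen .a) := by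
    rw [SemiconjBy]
    nth_rewrite 1 [cba_eq_acb]
    simp only [mul_assoc]
  have hc : SemiconjBy (gen .c * gen .b * gen .a) (gen .c) (gen .b) := by
    rw [SemiconjBy, ← bcba_eq_cbac]
    simp only [mul_assoc]
  have h := ((ha.mul_right hc).mul_right ha).eq
  rw [aba_eq_bab, ← ((hc.mul_right ha).mul_right hc).eq] at h
  exact mul_left_cancel h

/-- A common right multiple of `a` and `c` does not left-divide both `aca` and `acb`. -/
lemma not_leftDvd_aca_and_acb (m u v w w' : Gplus)
    (hu : (m : G) = gen .a * u) (hv : (m : G) = gen .c * v)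
    (hw : gen .a * gen .c * gen .a = m * w) (hw' : gen .a * gen .c * gen .b = m * w') : False := by
  obtain ⟨lu, eu⟩ := exists_ofWord_eq u
  obtain ⟨lv, ev⟩ := exists_ofWord_eq v
  obtain ⟨lw, ew⟩ := exists_ofWord_eq w
  obtain ⟨lw', ew'⟩ := exists_ofWord_eq w'
  rw [eu] at hu
  rw [ev, hu] at hv
  rw [ew, hu] at hw
  rw [ew', hu] at hw'
  have h₁ := congrArg (Multiplicative.toAdd ∘ wordLength) hv
  have h₂ := congrArg (Multiplicative.toAdd ∘ wordLength) hw
  have h₃ := congrArg (Multiplicative.toAdd ∘ wordLength) hw'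
  simp only [Function.comp_apply, map_mul, wordLength_gen, wordLength_ofWord, toAdd_mul,
    toAdd_ofAdd] at h₁ h₂ h₃
  match lu, lv, h₁, h₂, h₃ with
  | [], [], _, _, _ => exact absurd (gen_injective (by simpa using hv)) (by simp)
  | [x], [y], _, _, _ => exact gen_a_mul_ne_gen_c_mul x y (by simpa using hv)
  | _ :: _ :: _, _, _, h₂, h₃ =>
    simp only [List.length_cons, Nat.cast_succ] at h₂ h₃
    obtain rfl : lw = [] := List.length_eq_zero_iff.1 (by omega)
    obtain rfl : lw' = [] := List.length_eq_zero_iff.1 (by omega)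
    exact absurd (gen_injective (mul_left_cancel (hw.trans hw'.symm))) (by simp)
  | [], _ :: _, h₁, _, _ => simp only [List.length_cons, List.length_nil] at h₁; omega
  | [_], [], h₁, _, _ => simp at h₁
  | [_], _ :: _ :: _, h₁, _, _ => simp only [List.length_cons, List.length_nil] at h₁; omega

/-- A common left multiple of `a` and `b` does not right-divide both `aba` and `cba`. -/
lemma not_rightDvd_aba_and_cba (m u v w w' : Gplus)
    (hu : (m : G) = u * gen .a) (hv : (m : G) = v * gen .b)
    (hw : gen .a * gen .b * gen .a = w * m) (hw' : gen .c * gen .b * gen .a = w' * m) : False := by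
  obtain ⟨lu, eu⟩ := exists_ofWord_eq u
  obtain ⟨lv, ev⟩ := exists_ofWord_eq v
  obtain ⟨lw, ew⟩ := exists_ofWord_eq w
  obtain ⟨lw', ew'⟩ := exists_ofWord_eq w'
  rw [eu] at hu
  rw [ev, hu] at hv
  rw [ew, hu] at hw
  rw [ew', hu] at hw'
  have h₁ := congrArg (Multiplicative.toAdd ∘ wordLength) hv
  have h₂ := congrArg (Multiplicative.toAdd ∘ wordLength) hw
  have h₃ := congrArg (Multiplicative.toAdd ∘ wordLength) hw'
  simp only [Function.comp_apply, map_mul, wordLength_gen, wordLength_ofWord, toAdd_mul,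
    toAdd_ofAdd] at h₁ h₂ h₃
  match lu, lv, h₁, h₂, h₃ with
  | [], [], _, _, _ => exact absurd (gen_injective (by simpa using hv)) (by simp)
  | [x], [y], _, _, _ => exact mul_gen_a_ne_mul_gen_b x y (by simpa using hv)
  | _ :: _ :: _, _, _, h₂, h₃ =>
    simp only [List.length_cons, Nat.cast_succ] at h₂ h₃
    obtain rfl : lw = [] := List.length_eq_zero_iff.1 (by omega)
    obtain rfl : lw' = [] := List.length_eq_zero_iff.1 (by omega)
    exact absurd (gen_injective (mul_right_cancel (mul_right_cancel (hw.trans hw'.symm))))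
      (by simp)
  | [], _ :: _, h₁, _, _ => simp only [List.length_cons, List.length_nil] at h₁; omega
  | [_], [], h₁, _, _ => simp at h₁
  | [_], _ :: _ :: _, h₁, _, _ => simp only [List.length_cons, List.length_nil] at h₁; omega

/-- A generator as an element of `Gplus`. -/
def genPlus (x : Gen3) : Gplus := ⟨gen x, gen_mem x⟩

/-- `G_Hiii⁺` admits neither the left- nor the right-divisibility theory: it is not
the case that any two elements have a left least common multiple, nor that any two
elements have a right least common multiple. -/
theorem Gplus_no_divisibility_theory :
    (¬ ∀ x y : Gplus, ∃ m : Gplus,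
        (∃ w : Gplus, m = x * w) ∧ (∃ w : Gplus, m = y * w) ∧
        ∀ n : Gplus, (∃ w : Gplus, n = x * w) → (∃ w : Gplus, n = y * w) →
          ∃ w : Gplus, n = m * w) ∧
    (¬ ∀ x y : Gplus, ∃ m : Gplus,
        (∃ w : Gplus, m = w * x) ∧ (∃ w : Gplus, m = w * y) ∧
        ∀ n : Gplus, (∃ w : Gplus, n = w * x) → (∃ w : Gplus, n = w * y) →
          ∃ w : Gplus, n = w * m) := by
  constructor
  · intro h
    obtain ⟨m, ⟨u, hu⟩, ⟨v, hv⟩, hm⟩ := h (genPlus .a) (genPlus .c)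
    obtain ⟨w, hw⟩ := hm (genPlus .a * genPlus .c * genPlus .a)
      ⟨genPlus .c * genPlus .a, mul_assoc _ _ _⟩
      ⟨genPlus .a * genPlus .c, Subtype.ext (aca_eq_cac.trans (mul_assoc _ _ _))⟩
    obtain ⟨w', hw'⟩ := hm (genPlus .a * genPlus .c * genPlus .b)
      ⟨genPlus .c * genPlus .b, mul_assoc _ _ _⟩
      ⟨genPlus .b * genPlus .a, Subtype.ext (cba_eq_acb.symm.trans (mul_assoc _ _ _))⟩
    exact not_leftDvd_aca_and_acb m u v w w' (congrArg Subtype.val hu) (congrArg Subtype.val hv)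
      (congrArg Subtype.val hw) (congrArg Subtype.val hw')
  · intro h
    obtain ⟨m, ⟨u, hu⟩, ⟨v, hv⟩, hm⟩ := h (genPlus .a) (genPlus .b)
    obtain ⟨w, hw⟩ := hm (genPlus .a * genPlus .b * genPlus .a)
      ⟨genPlus .a * genPlus .b, rfl⟩ ⟨genPlus .b * genPlus .a, Subtype.ext aba_eq_bab⟩
    obtain ⟨w', hw'⟩ := hm (genPlus .c * genPlus .b * genPlus .a)
      ⟨genPlus .c * genPlus .b, rfl⟩ ⟨genPlus .a * genPlus .c, Subtype.ext cba_eq_acb⟩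
    exact not_rightDvd_aba_and_cba m u v w w' (congrArg Subtype.val hu) (congrArg Subtype.val hv)
      (congrArg Subtype.val hw) (congrArg Subtype.val hw')
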